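/- Let the dataset contain at least K distinct points and the communication graph be connected. Then the convergence of generalized minima to Lloyd's minima is uniform: for every ε > 0 there exists ρ_ε > 0 (depending only on the dataset D and the graph G) such that for all ρ ≥ ρ_ε, every x̆ ∈ M̄^ρ, and every agent m ∈ {1,…,M}, the distance d(x̆_m, Z̄) ≤ ε. Equivalently, lim_{ρ→∞} sup_{x̆∈M̄^ρ} max_{1≤m≤M} d(x̆_m, Z̄) = 0. -/

import Mathlib

open scoped BigOperators

noncomputable section

/-! ### Basic (centralized) K-means notions -/

/-- The dataset `D` contains at least `K` distinct points. -/
def HasKDistinct {p : ℕ} (K : ℕ) (D : Multiset (EuclideanSpace ℝ (Fin p))) : Prop :=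
  ∃ S : Finset (EuclideanSpace ℝ (Fin p)), S.card = K ∧ ∀ y ∈ S, y ∈ D

/-- The K-means clustering cost `F(x) = ∑_{y ∈ D} min_k ‖y - x^k‖²`. -/
def kmeansF {p : ℕ} (K : ℕ) (D : Multiset (EuclideanSpace ℝ (Fin p)))
    (x : Fin K → EuclideanSpace ℝ (Fin p)) : ℝ :=
  (D.map fun y => ⨅ k : Fin K, ‖y - x k‖ ^ 2).sum

/-- `P` is a partition of the multiset `D` into `K` (possibly empty) cells. -/
def IsKPartition {p K : ℕ} (D : Multiset (EuclideanSpace ℝ (Fin p)))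
    (P : Fin K → Multiset (EuclideanSpace ℝ (Fin p))) : Prop :=
  ∑ k, P k = D

/-- The distortion cost `H(x, P) = ∑_k ∑_{y ∈ P^k} ‖y - x^k‖²`. -/
def costH {p K : ℕ} (x : Fin K → EuclideanSpace ℝ (Fin p))
    (P : Fin K → Multiset (EuclideanSpace ℝ (Fin p))) : ℝ :=
  ∑ k, ((P k).map fun y => ‖y - x k‖ ^ 2).sum

/-- `(x, P)` is a Lloyd's minimum for the dataset `D`. -/
def IsLloydMin {p K : ℕ} (D : Multiset (EuclideanSpace ℝ (Fin p)))
    (x : Fin K → EuclideanSpace ℝ (Fin p))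
    (P : Fin K → Multiset (EuclideanSpace ℝ (Fin p))) : Prop :=
  IsKPartition D P ∧
    (∀ Q, IsKPartition D Q → costH x P ≤ costH x Q) ∧
    (∀ x', costH x P ≤ costH x' P)

/-- The set `Z` of Lloyd's minima (cluster-center tuples). -/
def LloydZ {p : ℕ} (K : ℕ) (D : Multiset (EuclideanSpace ℝ (Fin p))) :
    Set (Fin K → EuclideanSpace ℝ (Fin p)) :=
  {x | ∃ P, IsLloydMin D x P}

/-- The set `Z̄` of Lloyd's minima whose centers lie in the (closed) convex hull of `D`. -/
def LloydZbar {p : ℕ} (K : ℕ) (D : Multiset (EuclideanSpace ℝ (Fin p))) :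
    Set (Fin K → EuclideanSpace ℝ (Fin p)) :=
  {x ∈ LloydZ K D | ∀ k, x k ∈ convexHull ℝ {y | y ∈ D}}

/-- The set `Z_g` of global minimizers of the K-means cost `F`. -/
def kmeansZg {p : ℕ} (K : ℕ) (D : Multiset (EuclideanSpace ℝ (Fin p))) :
    Set (Fin K → EuclideanSpace ℝ (Fin p)) :=
  {x | ∀ x', kmeansF K D x ≤ kmeansF K D x'}

/-- The global minimum value `F*` of the K-means cost. -/
def Fstar {p : ℕ} (K : ℕ) (D : Multiset (EuclideanSpace ℝ (Fin p))) : ℝ :=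
  sInf (Set.range (kmeansF K D))

/-- `R₀ = max{‖v‖ : v ∈ closed convex hull of D}`. -/
def R0 {p : ℕ} (D : Multiset (EuclideanSpace ℝ (Fin p))) : ℝ :=
  sSup ((fun v => ‖v‖) '' convexHull ℝ {y | y ∈ D})

/-! ### Multi-agent notions -/

section Distributed

variable {p K M : ℕ}

/-- The multi-agent cost `J^ρ(x, C)`; each undirected edge is counted once in the
agreement term. -/
def costJ (ρ : ℝ) (G : SimpleGraph (Fin M)) [DecidableRel G.Adj]
    (x : Fin M → Fin K → EuclideanSpace ℝ (Fin p))
    (C : Fin M → Fin K → Multiset (EuclideanSpace ℝ (Fin p))) : ℝ :=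
  (1 / ρ) * ∑ m, ∑ k, ((C m k).map fun y => ‖y - x m k‖ ^ 2).sum +
    (1 / 2) * ∑ m, ∑ l ∈ G.neighborFinset m, ∑ k, ‖x m k - x l k‖ ^ 2

/-- The multi-agent cost `Q^ρ(x)`. -/
def costQ (ρ : ℝ) (G : SimpleGraph (Fin M)) [DecidableRel G.Adj]
    (Dm : Fin M → Multiset (EuclideanSpace ℝ (Fin p)))
    (x : Fin M → Fin K → EuclideanSpace ℝ (Fin p)) : ℝ :=
  (1 / ρ) * ∑ m, ((Dm m).map fun y => ⨅ k : Fin K, ‖y - x m k‖ ^ 2).sum +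
    (1 / 2) * ∑ m, ∑ l ∈ G.neighborFinset m, ∑ k, ‖x m k - x l k‖ ^ 2

/-- The set of global minimizers `M^ρ_g` of `Q^ρ`. -/
def globQ (ρ : ℝ) (G : SimpleGraph (Fin M)) [DecidableRel G.Adj]
    (Dm : Fin M → Multiset (EuclideanSpace ℝ (Fin p))) (K : ℕ) :
    Set (Fin M → Fin K → EuclideanSpace ℝ (Fin p)) :=
  {x | ∀ x' : Fin M → Fin K → EuclideanSpace ℝ (Fin p), costQ ρ G Dm x ≤ costQ ρ G Dm x'}

/-- `C ∈ U_x` : `C` is an admissible (Voronoi / nearest-center) clustering for `x`. -/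
def InVoronoi (Dm : Fin M → Multiset (EuclideanSpace ℝ (Fin p)))
    (x : Fin M → Fin K → EuclideanSpace ℝ (Fin p))
    (C : Fin M → Fin K → Multiset (EuclideanSpace ℝ (Fin p))) : Prop :=
  (∀ m, IsKPartition (Dm m) (C m)) ∧
    ∀ m k y, y ∈ C m k → ∀ k', ‖y - x m k‖ ≤ ‖y - x m k'‖

/-- The fixed-point (stationarity) equations
`((1/ρ)|C_m^k| + |Ω_m|) x_m^k = (1/ρ) ∑_{y ∈ C_m^k} y + ∑_{l ∈ Ω_m} x_l^k`. -/
def IsFixedCenters (ρ : ℝ) (G : SimpleGraph (Fin M)) [DecidableRel G.Adj]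
    (x : Fin M → Fin K → EuclideanSpace ℝ (Fin p))
    (C : Fin M → Fin K → Multiset (EuclideanSpace ℝ (Fin p))) : Prop :=
  ∀ m k, ((1 / ρ) * ((C m k).card : ℝ) + (G.degree m : ℝ)) • x m k =
      (1 / ρ) • (C m k).sum + ∑ l ∈ G.neighborFinset m, x l k

/-- `(x, C)` is a generalized Lloyd's minimum of `J^ρ`. -/
def IsGenLloydMin (ρ : ℝ) (G : SimpleGraph (Fin M)) [DecidableRel G.Adj]
    (Dm : Fin M → Multiset (EuclideanSpace ℝ (Fin p)))
    (x : Fin M → Fin K → EuclideanSpace ℝ (Fin p))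
    (C : Fin M → Fin K → Multiset (EuclideanSpace ℝ (Fin p))) : Prop :=
  InVoronoi Dm x C ∧ IsFixedCenters ρ G x C

/-- The set `M^ρ` of generalized Lloyd's minima (centers part). -/
def genM (ρ : ℝ) (G : SimpleGraph (Fin M)) [DecidableRel G.Adj]
    (Dm : Fin M → Multiset (EuclideanSpace ℝ (Fin p))) (K : ℕ) :
    Set (Fin M → Fin K → EuclideanSpace ℝ (Fin p)) :=
  {x | ∃ C, IsGenLloydMin ρ G Dm x C}

/-- The set `M̄^ρ` of generalized Lloyd's minima with all centers in the (closed)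
convex hull of the collective dataset `D`. -/
def genMbar (ρ : ℝ) (G : SimpleGraph (Fin M)) [DecidableRel G.Adj]
    (Dm : Fin M → Multiset (EuclideanSpace ℝ (Fin p)))
    (D : Multiset (EuclideanSpace ℝ (Fin p))) (K : ℕ) :
    Set (Fin M → Fin K → EuclideanSpace ℝ (Fin p)) :=
  {x ∈ genM ρ G Dm K | ∀ m k, x m k ∈ convexHull ℝ {y | y ∈ D}}

/-- The update target
`μ_m^k = ((1/ρ) ∑_{y ∈ C_m^k} y + ∑_{l ∈ Ω_m} x_l^k) / ((1/ρ)|C_m^k| + |Ω_m|)`. -/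
def muVec (ρ : ℝ) (G : SimpleGraph (Fin M)) [DecidableRel G.Adj]
    (x : Fin M → Fin K → EuclideanSpace ℝ (Fin p))
    (C : Fin M → Fin K → Multiset (EuclideanSpace ℝ (Fin p)))
    (m : Fin M) (k : Fin K) : EuclideanSpace ℝ (Fin p) :=
  ((1 / ρ) * ((C m k).card : ℝ) + (G.degree m : ℝ))⁻¹ •
    ((1 / ρ) • (C m k).sum + ∑ l ∈ G.neighborFinset m, x l k)

/-- `(x_t, C_t)` is a trajectory of the NK-means algorithm with parameters `ρ, α`. -/
def NKMeansSeq (ρ α : ℝ) (G : SimpleGraph (Fin M)) [DecidableRel G.Adj]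
    (Dm : Fin M → Multiset (EuclideanSpace ℝ (Fin p)))
    (x : ℕ → Fin M → Fin K → EuclideanSpace ℝ (Fin p))
    (C : ℕ → Fin M → Fin K → Multiset (EuclideanSpace ℝ (Fin p))) : Prop :=
  (∀ m, IsKPartition (Dm m) (C 0 m)) ∧
    ∀ t, (∀ m, IsKPartition (Dm m) (C (t + 1) m)) ∧
      (∀ m k y, y ∈ C (t + 1) m k → ∀ k', ‖y - x t m k‖ ≤ ‖y - x t m k'‖) ∧
      ∀ m k, x (t + 1) m k = x t m k - α • (x t m k - muVec ρ G (x t) (C (t + 1)) m k)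

/-- The minimum vertex degree `d_min` of the communication graph. -/
def minDeg (G : SimpleGraph (Fin M)) [DecidableRel G.Adj] : ℕ :=
  sInf (Set.range fun m : Fin M => G.degree m)

/-- The largest eigenvalue `λ_M(L)` of the graph Laplacian. -/
def lapLamMax (G : SimpleGraph (Fin M)) [DecidableRel G.Adj] : ℝ :=
  sSup (spectrum ℝ (G.lapMatrix ℝ))

/-- The second-smallest eigenvalue `λ₂(L)` of the graph Laplacian (for a connected
graph, the smallest nonzero eigenvalue). -/
def lapLam2 (G : SimpleGraph (Fin M)) [DecidableRel G.Adj] : ℝ :=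
  sInf {μ : ℝ | μ ∈ spectrum ℝ (G.lapMatrix ℝ) ∧ μ ≠ 0}

/-- `N* = max_m |D_m|`. -/
def Nstar (Dm : Fin M → Multiset (EuclideanSpace ℝ (Fin p))) : ℕ :=
  Finset.univ.sup fun m => (Dm m).card

/-- The step-size condition `0 < α < d_min / ((1/ρ) N* + λ_M(L))`. -/
def StepOK (ρ α : ℝ) (G : SimpleGraph (Fin M)) [DecidableRel G.Adj]
    (Dm : Fin M → Multiset (EuclideanSpace ℝ (Fin p))) : Prop :=
  0 < α ∧ α * ((1 / ρ) * (Nstar Dm : ℝ) + lapLamMax G) < (minDeg G : ℝ)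

/-- The constant `c(α) = 2α(d_min − α((1/ρ)N* + λ_M(L)))`. -/
def cAlpha (ρ α : ℝ) (G : SimpleGraph (Fin M)) [DecidableRel G.Adj]
    (Dm : Fin M → Multiset (EuclideanSpace ℝ (Fin p))) : ℝ :=
  2 * α * ((minDeg G : ℝ) - α * ((1 / ρ) * (Nstar Dm : ℝ) + lapLamMax G))

end Distributed
open Filter Topology

section Lloyd

variable {p K : ℕ}

theorem sum_map_norm_sub_sq (s : Multiset (EuclideanSpace ℝ (Fin p)))
    (z w : EuclideanSpace ℝ (Fin p)) :
    (s.map fun y => ‖y - w‖ ^ 2).sum = (s.map fun y => ‖y - z‖ ^ 2).sum +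
      2 * inner ℝ (s.sum - (s.card : ℝ) • z) (z - w) + (s.card : ℝ) * ‖z - w‖ ^ 2 := by
  induction s using Multiset.induction_on with
  | empty => simp
  | cons a s ih =>
    have h : ‖a - w‖ ^ 2 = ‖a - z‖ ^ 2 + 2 * inner ℝ (a - z) (z - w) + ‖z - w‖ ^ 2 := by
      rw [← norm_add_sq_real, sub_add_sub_cancel]
    have h' : a + s.sum - ((s.card : ℝ) + 1) • z = (a - z) + (s.sum - (s.card : ℝ) • z) := by
      module
    simp only [Multiset.map_cons, Multiset.sum_cons, Multiset.card_cons, Nat.cast_add,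
      Nat.cast_one, ih, h, h', inner_add_left]
    ring

theorem costH_le_of_centroid {x : Fin K → EuclideanSpace ℝ (Fin p)}
    {P : Fin K → Multiset (EuclideanSpace ℝ (Fin p))}
    (h : ∀ k, ((P k).card : ℝ) • x k = (P k).sum) (x' : Fin K → EuclideanSpace ℝ (Fin p)) :
    costH x P ≤ costH x' P := by
  refine Finset.sum_le_sum fun k _ => ?_
  rw [sum_map_norm_sub_sq (P k) (x k) (x' k), h k, sub_self, inner_zero_left]
  have : 0 ≤ ((P k).card : ℝ) * ‖x k - x' k‖ ^ 2 := by positivity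
  linarith

theorem sum_map_eq_of_isKPartition {D : Multiset (EuclideanSpace ℝ (Fin p))}
    {P : Fin K → Multiset (EuclideanSpace ℝ (Fin p))} (hP : IsKPartition D P)
    (f : EuclideanSpace ℝ (Fin p) → ℝ) : ∑ k, ((P k).map f).sum = (D.map f).sum := by
  rw [← show ∑ k, P k = D from hP]
  exact (map_sum (Multiset.sumAddMonoidHom.comp (Multiset.mapAddMonoidHom f)) P _).symm

theorem kmeansF_le_costH {D : Multiset (EuclideanSpace ℝ (Fin p))}
    {Q : Fin K → Multiset (EuclideanSpace ℝ (Fin p))} (hQ : IsKPartition D Q)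
    (x : Fin K → EuclideanSpace ℝ (Fin p)) : kmeansF K D x ≤ costH x Q := by
  rw [kmeansF, ← sum_map_eq_of_isKPartition hQ]
  exact Finset.sum_le_sum fun k _ => Multiset.sum_map_le_sum_map _ _ fun y _ =>
    ciInf_le (Set.finite_range _).bddBelow k

theorem costH_eq_kmeansF {D : Multiset (EuclideanSpace ℝ (Fin p))}
    {P : Fin K → Multiset (EuclideanSpace ℝ (Fin p))} (hP : IsKPartition D P)
    {x : Fin K → EuclideanSpace ℝ (Fin p)}
    (h : ∀ k, ∀ y ∈ P k, ∀ k', ‖y - x k‖ ≤ ‖y - x k'‖) : costH x P = kmeansF K D x := by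
  rw [kmeansF, ← sum_map_eq_of_isKPartition hP]
  refine Finset.sum_congr rfl fun k _ => congrArg _ (Multiset.map_congr rfl fun y hy => ?_)
  have : Nonempty (Fin K) := ⟨k⟩
  refine le_antisymm (le_ciInf fun k' => ?_) (ciInf_le (Set.finite_range _).bddBelow k)
  have := h k y hy k'
  gcongr

theorem isLloydMin_of_nearest_of_centroid {D : Multiset (EuclideanSpace ℝ (Fin p))}
    {P : Fin K → Multiset (EuclideanSpace ℝ (Fin p))} (hP : IsKPartition D P)
    {x : Fin K → EuclideanSpace ℝ (Fin p)}
    (hnear : ∀ k, ∀ y ∈ P k, ∀ k', ‖y - x k‖ ≤ ‖y - x k'‖)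
    (hcent : ∀ k, ((P k).card : ℝ) • x k = (P k).sum) : IsLloydMin D x P :=
  ⟨hP, fun _ hQ => (costH_eq_kmeansF hP hnear).trans_le (kmeansF_le_costH hQ x),
    costH_le_of_centroid hcent⟩

end Lloyd

section Network

variable {p K M : ℕ}

theorem sum_degree_smul {E : Type*} [AddCommGroup E] [Module ℝ E] (G : SimpleGraph (Fin M))
    [DecidableRel G.Adj] (v : Fin M → E) :
    ∑ m, (G.degree m : ℝ) • v m = ∑ m, ∑ l ∈ G.neighborFinset m, v l := by
  rw [Finset.sum_comm' (t' := Finset.univ) (s' := fun l => G.neighborFinset l)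
    (by simp [G.adj_comm])]
  simp [Nat.cast_smul_eq_nsmul]

theorem eq_of_degree_smul_eq_sum {G : SimpleGraph (Fin M)} [DecidableRel G.Adj]
    (hG : G.Connected) {v : Fin M → EuclideanSpace ℝ (Fin p)}
    (h : ∀ m, (G.degree m : ℝ) • v m = ∑ l ∈ G.neighborFinset m, v l) (m l : Fin M) :
    v m = v l := by
  ext i
  refine (G.lapMatrix_mulVec_eq_zero_iff_forall_reachable (x := fun m => v m i)).1 ?_ m l
    (hG.preconnected m l)
  funext j
  have := congrArg (fun u : EuclideanSpace ℝ (Fin p) => u i) (h j)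
  simp only [PiLp.smul_apply, smul_eq_mul, WithLp.ofLp_sum, Finset.sum_apply] at this
  rw [SimpleGraph.lapMatrix_mulVec_apply, this]
  simp

theorem IsFixedCenters.sum_card_smul {ρ : ℝ} (hρ : ρ ≠ 0) {G : SimpleGraph (Fin M)}
    [DecidableRel G.Adj] {x : Fin M → Fin K → EuclideanSpace ℝ (Fin p)}
    {C : Fin M → Fin K → Multiset (EuclideanSpace ℝ (Fin p))} (h : IsFixedCenters ρ G x C)
    (k : Fin K) : ∑ m, ((C m k).card : ℝ) • x m k = ∑ m, (C m k).sum := by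
  have h1 := Finset.sum_congr (rfl : (Finset.univ : Finset (Fin M)) = _) fun m _ => h m k
  simp only [add_smul, Finset.sum_add_distrib, mul_smul, ← Finset.smul_sum] at h1
  rw [sum_degree_smul G fun m => x m k, add_left_inj] at h1
  exact smul_right_injective _ (one_div_ne_zero hρ) h1

theorem isKPartition_sum {Dm : Fin M → Multiset (EuclideanSpace ℝ (Fin p))}
    {C : Fin M → Fin K → Multiset (EuclideanSpace ℝ (Fin p))}
    (h : ∀ m, IsKPartition (Dm m) (C m)) :
    IsKPartition (∑ m, Dm m) fun k => ∑ m, C m k := by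
  unfold IsKPartition
  rw [Finset.sum_comm]
  exact Finset.sum_congr rfl fun m _ => h m

/-- A limit of generalized Lloyd's minima with a common clustering, along penalties tending to
infinity, is a consensus configuration at a Lloyd's minimum. -/
theorem isLloydMin_of_tendsto {Dm : Fin M → Multiset (EuclideanSpace ℝ (Fin p))}
    {G : SimpleGraph (Fin M)} [DecidableRel G.Adj] (hG : G.Connected)
    {C : Fin M → Fin K → Multiset (EuclideanSpace ℝ (Fin p))} {ρ : ℕ → ℝ}
    (hρ : Tendsto ρ atTop atTop) {x : ℕ → Fin M → Fin K → EuclideanSpace ℝ (Fin p)}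
    (hx : ∀ n, IsGenLloydMin (ρ n) G Dm (x n) C)
    {z : Fin M → Fin K → EuclideanSpace ℝ (Fin p)} (hz : Tendsto x atTop (𝓝 z)) (m : Fin M) :
    IsLloydMin (∑ m, Dm m) (z m) fun k => ∑ m, C m k := by
  have hlim : ∀ m k, Tendsto (fun n => x n m k) atTop (𝓝 (z m k)) := fun m k =>
    tendsto_pi_nhds.1 (tendsto_pi_nhds.1 hz m) k
  have hinv : Tendsto (fun n => 1 / ρ n) atTop (𝓝 0) := by
    simpa only [one_div, Function.comp_def] using tendsto_inv_atTop_zero.comp hρ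
  have hcons : ∀ k l, z l k = z m k := fun k l => by
    refine eq_of_degree_smul_eq_sum hG (v := fun m => z m k) (fun j => ?_) l m
    refine tendsto_nhds_unique_of_eventuallyEq
      (f := fun n => ((1 / ρ n) * ((C j k).card : ℝ) + (G.degree j : ℝ)) • x n j k)
      (g := fun n => (1 / ρ n) • (C j k).sum + ∑ l ∈ G.neighborFinset j, x n l k) (l := atTop)
      ?_ ?_ (Eventually.of_forall fun n => (hx n).2 j k)
    · simpa using ((hinv.mul_const ((C j k).card : ℝ)).add_const (G.degree j : ℝ)).smul (hlim j k)
    · simpa using (hinv.smul_const (C j k).sum).add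
        (tendsto_finsetSum (G.neighborFinset j) fun l _ => hlim l k)
  refine isLloydMin_of_nearest_of_centroid (isKPartition_sum (hx 0).1.1) ?_ ?_
  · intro k y hy k'
    obtain ⟨j, -, hj⟩ := Multiset.mem_sum.1 hy
    rw [← hcons k j, ← hcons k' j]
    exact le_of_tendsto_of_tendsto' (tendsto_const_nhds.sub (hlim j k)).norm
      (tendsto_const_nhds.sub (hlim j k')).norm fun n => (hx n).1.2 j k y hj k'
  · intro k
    have h1 : Tendsto (fun n => ∑ j, ((C j k).card : ℝ) • x n j k) atTop
        (𝓝 (∑ j, ((C j k).card : ℝ) • z j k)) :=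
      tendsto_finsetSum _ fun j _ => (hlim j k).const_smul _
    have h2 : ∑ j, ((C j k).card : ℝ) • z j k = ∑ j, (C j k).sum :=
      tendsto_nhds_unique_of_eventuallyEq h1 tendsto_const_nhds <|
        (hρ.eventually_ne_atTop 0).mono fun n hn => (hx n).2.sum_card_smul hn k
    simp only [hcons] at h2
    rw [← Finset.sum_smul] at h2
    rw [Multiset.card_sum, Nat.cast_sum, h2]
    exact (map_sum Multiset.sumAddMonoidHom (fun j => C j k) _).symm

theorem finite_setOf_isKPartition (Dm : Fin M → Multiset (EuclideanSpace ℝ (Fin p))) (K : ℕ) :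
    {C : Fin M → Fin K → Multiset (EuclideanSpace ℝ (Fin p)) |
      ∀ m, IsKPartition (Dm m) (C m)}.Finite := by
  classical
  refine (Set.Finite.pi' fun m => Set.Finite.pi' fun _ : Fin K =>
    Set.finite_Iic (Dm m)).subset fun C hC m k => ?_
  change C m k ≤ Dm m
  rw [← show ∑ k, C m k = Dm m from hC m]
  exact Finset.single_le_sum (fun _ _ => Multiset.zero_le _) (Finset.mem_univ k)

theorem eventually_infDist_le {Dm : Fin M → Multiset (EuclideanSpace ℝ (Fin p))}
    {G : SimpleGraph (Fin M)} [DecidableRel G.Adj] (hG : G.Connected)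
    (C : Fin M → Fin K → Multiset (EuclideanSpace ℝ (Fin p))) {ε : ℝ} (hε : 0 < ε) :
    ∀ᶠ ρ in atTop, ∀ x, IsGenLloydMin ρ G Dm x C →
      (∀ m k, x m k ∈ convexHull ℝ {y | y ∈ ∑ m, Dm m}) →
      ∀ m, Metric.infDist (x m) (LloydZbar K (∑ m, Dm m)) ≤ ε := by
  by_contra hcon
  obtain ⟨ρ, hρ, hfail⟩ := exists_seq_forall_of_frequently (not_eventually.1 hcon)
  push Not at hfail
  choose x hx hhull m hm using hfail
  have hcompact : IsCompact (convexHull ℝ {y | y ∈ ∑ m, Dm m}) :=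
    ((∑ m, Dm m).finite_toSet).isCompact_convexHull ℝ
  obtain ⟨z, hz, φ, hφ, hlim⟩ := (isCompact_univ_pi fun _ : Fin M =>
    isCompact_univ_pi fun _ : Fin K => hcompact).tendsto_subseq
      fun n => fun m _ k _ => hhull n m k
  have hzmem : ∀ m, z m ∈ LloydZbar K (∑ m, Dm m) := fun m =>
    ⟨⟨_, isLloydMin_of_tendsto hG (hρ.comp hφ.tendsto_atTop) (fun n => hx (φ n)) hlim m⟩,
      fun k => hz m trivial k trivial⟩
  obtain ⟨n, hn⟩ := (Metric.tendsto_nhds.1 hlim ε hε).exists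
  exact absurd ((Metric.infDist_le_dist_of_mem (hzmem _)).trans (dist_le_pi_dist _ z (m (φ n))))
    (hn.trans (hm (φ n))).not_ge

end Network

/-- Corollary 2: uniform convergence of generalized minima to the
set `Z̄` of Lloyd's minima: for every `ε > 0` there is `ρ_ε > 0` such that for all
`ρ ≥ ρ_ε`, every `x̆ ∈ M̄^ρ`, and every agent `m`, `d(x̆_m, Z̄) ≤ ε`. -/
theorem stmt3 {p K M : ℕ} (hK2 : 2 ≤ K)
    (Dm : Fin M → Multiset (EuclideanSpace ℝ (Fin p)))
    (D : Multiset (EuclideanSpace ℝ (Fin p))) (hD : ∑ m, Dm m = D)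
    (hdistinct : HasKDistinct K D)
    (G : SimpleGraph (Fin M)) [DecidableRel G.Adj] (hconn : G.Connected) :
    ∀ ε : ℝ, 0 < ε → ∃ ρε : ℝ, 0 < ρε ∧ ∀ ρ : ℝ, ρε ≤ ρ →
      ∀ x ∈ genMbar ρ G Dm D K, ∀ m, Metric.infDist (x m) (LloydZbar K D) ≤ ε := by
  intro ε hε
  subst hD
  have hev := (finite_setOf_isKPartition Dm K).eventually_all.2 fun C _ =>
    eventually_infDist_le (Dm := Dm) hconn C hε
  obtain ⟨r, hr⟩ := eventually_atTop.1 hev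
  refine ⟨max r 1, by positivity, fun ρ hρ x hx m => ?_⟩
  obtain ⟨⟨C, hC⟩, hhull⟩ := hx
  exact hr ρ ((le_max_left _ _).trans hρ) C hC.1.1 x hC hhull m
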